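/- Let Ω ⊂ ℝ³ be a bounded open set, let ε > 0, and let u ∈ C¹(Ω̄, ℂ), A ∈ C¹(Ω̄, ℝ³). Then 4 F_ε(u,A) ≥ ∫_0^1 ((1 − t²)/ε) · ℋ²({x ∈ Ω : |u(x)| = t}) dt, where the integral on the right is taken with respect to Lebesgue measure in t. -/

import Mathlib

open MeasureTheory
open scoped BigOperators

noncomputable section

/-- Partial derivative in the `k`-th coordinate direction of a scalar function on `ℝ³`. -/
def pderiv3 (f : EuclideanSpace ℝ (Fin 3) → ℝ) (k : Fin 3)
    (x : EuclideanSpace ℝ (Fin 3)) : ℝ :=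
  fderiv ℝ f x (EuclideanSpace.single k 1)

/-- The curl of a vector field on `ℝ³`. -/
def curl3 (A : EuclideanSpace ℝ (Fin 3) → EuclideanSpace ℝ (Fin 3))
    (x : EuclideanSpace ℝ (Fin 3)) : EuclideanSpace ℝ (Fin 3) :=
  (WithLp.equiv 2 (Fin 3 → ℝ)).symm
    ![pderiv3 (fun y => A y 2) 1 x - pderiv3 (fun y => A y 1) 2 x,
      pderiv3 (fun y => A y 0) 2 x - pderiv3 (fun y => A y 2) 0 x,
      pderiv3 (fun y => A y 1) 0 x - pderiv3 (fun y => A y 0) 1 x]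

/-- The Ginzburg–Landau free energy
`F_ε(u,A) = (1/2)∫_Ω |∇u − iAu|² + (1/(2ε²))(1 − |u|²)² + |curl A|²`. -/
def freeEnergy3 (ε : ℝ) (u : EuclideanSpace ℝ (Fin 3) → ℂ)
    (A : EuclideanSpace ℝ (Fin 3) → EuclideanSpace ℝ (Fin 3))
    (Ω : Set (EuclideanSpace ℝ (Fin 3))) : ℝ :=
  (1 / 2) * ∫ x in Ω,
    ((∑ k : Fin 3, ‖fderiv ℝ u x (EuclideanSpace.single k 1)
        - Complex.I * (A x k : ℂ) * u x‖ ^ 2)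
      + (1 / (2 * ε ^ 2)) * (1 - ‖u x‖ ^ 2) ^ 2 + ‖curl3 A x‖ ^ 2)

open Filter Topology Metric Set
open scoped ENNReal

/-- Eilenberg-type inequality: an infinitesimal estimate on small balls bounds the integral of the
Hausdorff measures of the fibers of `ρ`. -/
theorem lintegral_hausdorffMeasure_fiber_le {X : Type*} [MetricSpace X]
    [SecondCountableTopology X] [MeasurableSpace X] [BorelSpace X] [HasBesicovitchCovering X]
    {d : ℝ} (hd : 0 < d) (s : Set X) (ρ : X → ℝ) (μ : Measure X) [IsFiniteMeasure μ]
    (ν : Measure ℝ) (L : X → ℝ)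
    (hloc : ∀ x ∈ s, ∀ᶠ r in 𝓝[>] (0 : ℝ),
      (∀ y ∈ closedBall x r, |ρ y - ρ x| ≤ L x * r) ∧
      ENNReal.ofReal (2 * r) ^ d * ν (closedBall (ρ x) (L x * r)) ≤ μ (closedBall x r)) :
    ∫⁻ t, μH[d] {x ∈ s | ρ x = t} ∂ν ≤ μ s := by
  have hcover : ∀ n : ℕ, ∃ (T : Set X) (r : X → ℝ), T.Countable ∧ T ⊆ s ∧
      (∀ x ∈ T, r x ∈ {r : ℝ | 0 < r ∧ r < 1 / ((n : ℝ) + 1) ∧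
        (∀ y ∈ closedBall x r, |ρ y - ρ x| ≤ L x * r) ∧
        ENNReal.ofReal (2 * r) ^ d * ν (closedBall (ρ x) (L x * r)) ≤ μ (closedBall x r)}) ∧
      (s ⊆ ⋃ x ∈ T, closedBall x (r x)) ∧
      (∑' x : T, μ (closedBall x (r x))) ≤ μ s + ((n : ℝ≥0∞))⁻¹ := by
    intro n
    refine Besicovitch.exists_closedBall_covering_tsum_measure_le μ
      (by simp)
      (fun x => {r : ℝ | 0 < r ∧ r < 1 / ((n : ℝ) + 1) ∧
        (∀ y ∈ closedBall x r, |ρ y - ρ x| ≤ L x * r) ∧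
        ENNReal.ofReal (2 * r) ^ d * ν (closedBall (ρ x) (L x * r)) ≤ μ (closedBall x r)}) s ?_
    intro x hx δ hδ
    have h1 : ∀ᶠ r in 𝓝[>] (0 : ℝ), r ∈ Ioo (0 : ℝ) δ := Ioo_mem_nhdsGT hδ
    have h2 : ∀ᶠ r in 𝓝[>] (0 : ℝ), r ∈ Ioo (0 : ℝ) (1 / ((n : ℝ) + 1)) :=
      Ioo_mem_nhdsGT (by positivity)
    obtain ⟨r, hr, hr1, hr2⟩ := ((hloc x hx).and (h1.and h2)).exists
    exact ⟨r, ⟨hr1.1, hr2.2, hr.1, hr.2⟩, hr1⟩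
  choose T r hTc hTs hr hsT hsum using hcover
  have hcount : ∀ n, Countable (T n) := fun n => (hTc n).to_subtype
  let F : ℕ → ℝ → ℝ≥0∞ := fun n t => ∑' i : T n,
    (closedBall (ρ i) (L i * r n i)).indicator (fun _ => ENNReal.ofReal (2 * r n i) ^ d) t
  have hFm : ∀ n, Measurable (F n) := fun n =>
    Measurable.tsum fun i => measurable_const.indicator measurableSet_closedBall
  have hdiam : ∀ n (i : T n) (t : ℝ),
      ediam (closedBall (i : X) (r n i) ∩ {x ∈ s | ρ x = t}) ≤ ENNReal.ofReal (2 * r n i) := by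
    intro n i t
    have h0 := (hr n i i.2).1
    refine (ediam_mono inter_subset_left).trans ?_
    rw [← closedEBall_ofReal h0.le, ENNReal.ofReal_mul zero_le_two]
    simpa using ediam_closedEBall_le
  have hpt : ∀ t, μH[d] {x ∈ s | ρ x = t} ≤ liminf (fun n => F n t) atTop := by
    intro t
    have hlim : Tendsto (fun n : ℕ => ENNReal.ofReal (2 * (1 / ((n : ℝ) + 1)))) atTop (𝓝 0) := by
      have h := (tendsto_one_div_add_atTop_nhds_zero_nat (𝕜 := ℝ)).const_mul 2
      rw [mul_zero] at h
      simpa using ENNReal.tendsto_ofReal h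
    refine (Measure.hausdorffMeasure_le_liminf_tsum d {x ∈ s | ρ x = t} _ hlim
      (fun n (i : T n) => closedBall (i : X) (r n i) ∩ {x ∈ s | ρ x = t})
      (Eventually.of_forall fun n i => (hdiam n i t).trans ?_)
      (Eventually.of_forall fun n => ?_)).trans ?_
    · exact ENNReal.ofReal_le_ofReal (by linarith [(hr n i i.2).2.1])
    · intro x hx
      obtain ⟨y, hy, hxy⟩ := mem_iUnion₂.1 (hsT n hx.1)
      exact mem_iUnion.2 ⟨⟨y, hy⟩, hxy, hx⟩
    · refine liminf_le_liminf (Eventually.of_forall fun n => ENNReal.tsum_le_tsum fun i => ?_)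
      rcases (closedBall (i : X) (r n i) ∩ {x ∈ s | ρ x = t}).eq_empty_or_nonempty with he | hne
      · simp [he, hd]
      · obtain ⟨y, hy, -, rfl⟩ := hne
        rw [indicator_of_mem]
        · exact ENNReal.rpow_le_rpow (hdiam n i _) hd.le
        · rw [mem_closedBall, Real.dist_eq]
          exact (hr n i i.2).2.2.1 y hy
  have hlim : Tendsto (fun n : ℕ => μ s + ((n : ℝ≥0∞))⁻¹) atTop (𝓝 (μ s)) := by
    simpa using ENNReal.tendsto_inv_nat_nhds_zero.const_add (μ s)
  calc ∫⁻ t, μH[d] {x ∈ s | ρ x = t} ∂ν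
      ≤ ∫⁻ t, liminf (fun n => F n t) atTop ∂ν := lintegral_mono hpt
    _ ≤ liminf (fun n => ∫⁻ t, F n t ∂ν) atTop := lintegral_liminf_le hFm
    _ ≤ liminf (fun n : ℕ => μ s + ((n : ℝ≥0∞))⁻¹) atTop := by
        refine liminf_le_liminf (Eventually.of_forall fun n => ?_)
        refine le_trans ?_ (hsum n)
        rw [lintegral_tsum fun i =>
          (measurable_const.indicator measurableSet_closedBall).aemeasurable]
        refine ENNReal.tsum_le_tsum fun i => ?_
        rw [lintegral_indicator_const measurableSet_closedBall]
        exact (hr n i i.2).2.2.2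
    _ = μ s := hlim.liminf_eq

/-- A function that is `C¹` up to the boundary of a bounded open set has bounded derivative. -/
theorem ContDiffOn.exists_bound_fderiv_of_closure {E F : Type*} [NormedAddCommGroup E]
    [NormedSpace ℝ E] [ProperSpace E] [NormedAddCommGroup F] [NormedSpace ℝ F] {f : E → F}
    {s : Set E} (hf : ContDiffOn ℝ 1 f (closure s)) (hs : IsOpen s)
    (hb : Bornology.IsBounded s) : ∃ C : ℝ, ∀ x ∈ s, ‖fderiv ℝ f x‖ ≤ C := by
  have hK : IsCompact (closure s) := hb.isCompact_closure
  suffices h : ∃ C : ℝ, ∀ x ∈ s ∩ closure s, ‖fderiv ℝ f x‖ ≤ C by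
    simpa only [inter_eq_left.2 subset_closure] using h
  refine hK.induction_on (p := fun t => ∃ C : ℝ, ∀ x ∈ s ∩ t, ‖fderiv ℝ f x‖ ≤ C) ?_ ?_ ?_ ?_
  · simp
  · rintro t t' htt' ⟨C, hC⟩
    exact ⟨C, fun x hx => hC x ⟨hx.1, htt' hx.2⟩⟩
  · rintro t t' ⟨C, hC⟩ ⟨C', hC'⟩
    refine ⟨max C C', fun x hx => ?_⟩
    rcases hx.2 with h | h
    · exact (hC x ⟨hx.1, h⟩).trans (le_max_left _ _)
    · exact (hC' x ⟨hx.1, h⟩).trans (le_max_right _ _)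
  · intro x hx
    have h1 : ContDiffWithinAt ℝ (0 + 1) f (closure s) x := by simpa using hf x hx
    obtain ⟨v, hv, -, f', hf', hc⟩ :=
      (contDiffWithinAt_succ_iff_hasFDerivWithinAt (by simp)).1 h1
    rw [insert_eq_of_mem hx] at hv
    have hb : ∀ᶠ y in 𝓝[closure s] x, ‖f' y‖ < ‖f' x‖ + 1 :=
      (nhdsWithin_le_of_mem hv) (hc.continuousWithinAt.norm.eventually (gt_mem_nhds (by simp)))
    have hv' : ∀ᶠ y in 𝓝[closure s] x, v ∈ 𝓝[closure s] y := eventually_eventually_nhdsWithin.2 hv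
    refine ⟨{y | v ∈ 𝓝[closure s] y ∧ ‖f' y‖ < ‖f' x‖ + 1}, hv'.and hb, ‖f' x‖ + 1, ?_⟩
    rintro y ⟨hys, hyv, hy⟩
    rw [nhdsWithin_eq_nhds.2 (mem_of_superset (hs.mem_nhds hys) subset_closure)] at hyv
    rw [((hf' y (mem_of_mem_nhds hyv)).hasFDerivAt hyv).fderiv]
    exact hy.le

/-- Diamagnetic inequality, in difference-quotient form. -/
theorem eventually_abs_norm_sub_norm_le {E : Type*} [NormedAddCommGroup E] [NormedSpace ℝ E]
    {u : E → ℂ} {x : E} (hu : DifferentiableAt ℝ u x) (a : E →L[ℝ] ℝ) {D : ℝ}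
    (hD : ∀ v, ‖fderiv ℝ u x v - Complex.I * (a v : ℂ) * u x‖ ≤ D * ‖v‖) {κ : ℝ} (hκ : 0 < κ) :
    ∀ᶠ y in 𝓝 x, |‖u y‖ - ‖u x‖| ≤ (D + κ) * ‖y - x‖ := by
  have ha : HasFDerivAt (fun y => -((a (y - x) : ℝ) : ℂ) * Complex.I)
      ((-(Complex.ofRealCLM.comp a)).smulRight Complex.I) x := by
    have h := ((-(Complex.ofRealCLM.comp a)).smulRight Complex.I).hasFDerivAt (x := x)
    refine (h.sub_const (((-(Complex.ofRealCLM.comp a)).smulRight Complex.I) x)).congr_of_eventuallyEq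
      (Eventually.of_forall fun y => ?_)
    simp
    ring
  have h := hu.hasFDerivAt.mul ha.cexp
  filter_upwards [h.isLittleO.def hκ] with y hy
  have hnorm : ‖u y * Complex.exp (-((a (y - x) : ℝ) : ℂ) * Complex.I)‖ = ‖u y‖ := by
    rw [norm_mul, ← Complex.ofReal_neg, Complex.norm_exp_ofReal_mul_I, mul_one]
  have h1 := abs_norm_sub_norm_le
    (u y * Complex.exp (-((a (y - x) : ℝ) : ℂ) * Complex.I)) (u x)
  rw [hnorm] at h1
  have h2 := hD (y - x)
  simp only [sub_self, map_zero, Complex.ofReal_zero, neg_zero, zero_mul, Complex.exp_zero,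
    one_smul] at hy
  set w := u y * Complex.exp (-((a (y - x) : ℝ) : ℂ) * Complex.I) - u x with hw
  set l := fderiv ℝ u x (y - x) - Complex.I * (a (y - x) : ℂ) * u x with hl
  have hy' : ‖w - l‖ ≤ κ * ‖y - x‖ := by
    refine le_of_eq_of_le (congrArg _ ?_) hy
    simp [hw, hl]
    ring
  have := norm_sub_norm_le w l
  nlinarith

theorem norm_le_sqrt_sum_mul_norm {L : EuclideanSpace ℝ (Fin 3) →L[ℝ] ℂ}
    (v : EuclideanSpace ℝ (Fin 3)) :
    ‖L v‖ ≤ √(∑ k, ‖L (EuclideanSpace.single k 1)‖ ^ 2) * ‖v‖ := by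
  have hv : L v = ∑ k, v k • L (EuclideanSpace.single k 1) := by
    conv_lhs => rw [← (EuclideanSpace.basisFun (Fin 3) ℝ).sum_repr v]
    simp
  rw [hv, EuclideanSpace.norm_eq]
  calc ‖∑ k, v k • L (EuclideanSpace.single k 1)‖
      ≤ ∑ k, ‖L (EuclideanSpace.single k 1)‖ * ‖v k‖ := by
        refine (norm_sum_le _ _).trans (Finset.sum_le_sum fun k _ => ?_)
        rw [norm_smul, mul_comm]
    _ ≤ _ := Real.sum_mul_le_sqrt_mul_sqrt _ _ _

/-- The integrand of `freeEnergy3`. -/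
def freeEnergyDensity3 (ε : ℝ) (u : EuclideanSpace ℝ (Fin 3) → ℂ)
    (A : EuclideanSpace ℝ (Fin 3) → EuclideanSpace ℝ (Fin 3))
    (x : EuclideanSpace ℝ (Fin 3)) : ℝ :=
  (∑ k : Fin 3, ‖fderiv ℝ u x (EuclideanSpace.single k 1)
      - Complex.I * (A x k : ℂ) * u x‖ ^ 2)
    + (1 / (2 * ε ^ 2)) * (1 - ‖u x‖ ^ 2) ^ 2 + ‖curl3 A x‖ ^ 2

theorem freeEnergyDensity3_nonneg (ε : ℝ) (u : EuclideanSpace ℝ (Fin 3) → ℂ)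
    (A : EuclideanSpace ℝ (Fin 3) → EuclideanSpace ℝ (Fin 3)) (x : EuclideanSpace ℝ (Fin 3)) :
    0 ≤ freeEnergyDensity3 ε u A x := by
  unfold freeEnergyDensity3
  positivity

section

variable {Ω : Set (EuclideanSpace ℝ (Fin 3))} {u : EuclideanSpace ℝ (Fin 3) → ℂ}
  {A : EuclideanSpace ℝ (Fin 3) → EuclideanSpace ℝ (Fin 3)}

theorem ContDiffOn.continuousOn_pderiv3 {f : EuclideanSpace ℝ (Fin 3) → ℝ} (hΩo : IsOpen Ω)
    (hf : ContDiffOn ℝ 1 f (closure Ω)) (k : Fin 3) : ContinuousOn (pderiv3 f k) Ω :=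
  ((hf.mono subset_closure).continuousOn_fderiv_of_isOpen hΩo le_rfl).clm_apply continuousOn_const

theorem ContDiffOn.exists_bound_pderiv3 {f : EuclideanSpace ℝ (Fin 3) → ℝ} (hΩo : IsOpen Ω)
    (hΩb : Bornology.IsBounded Ω) (hf : ContDiffOn ℝ 1 f (closure Ω)) (k : Fin 3) :
    ∃ C : ℝ, ∀ x ∈ Ω, ‖pderiv3 f k x‖ ≤ C := by
  obtain ⟨C, hC⟩ := hf.exists_bound_fderiv_of_closure hΩo hΩb
  refine ⟨C, fun x hx => ?_⟩
  have := (fderiv ℝ f x).le_opNorm (EuclideanSpace.single k 1)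
  simp only [PiLp.norm_single, norm_one, mul_one] at this
  exact this.trans (hC x hx)

theorem norm_curl3_sq (A : EuclideanSpace ℝ (Fin 3) → EuclideanSpace ℝ (Fin 3))
    (x : EuclideanSpace ℝ (Fin 3)) :
    ‖curl3 A x‖ ^ 2 =
      ‖pderiv3 (fun y => A y 2) 1 x - pderiv3 (fun y => A y 1) 2 x‖ ^ 2
      + ‖pderiv3 (fun y => A y 0) 2 x - pderiv3 (fun y => A y 2) 0 x‖ ^ 2
      + ‖pderiv3 (fun y => A y 1) 0 x - pderiv3 (fun y => A y 0) 1 x‖ ^ 2 := by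
  rw [EuclideanSpace.norm_sq_eq, Fin.sum_univ_three]
  simp [curl3]

theorem continuousOn_freeEnergyDensity3 (hΩo : IsOpen Ω) (ε : ℝ)
    (hu : ContDiffOn ℝ 1 u (closure Ω)) (hA : ContDiffOn ℝ 1 A (closure Ω)) :
    ContinuousOn (freeEnergyDensity3 ε u A) Ω := by
  have hAk : ∀ k, ContDiffOn ℝ 1 (fun y => A y k) (closure Ω) := fun k =>
    (contDiffOn_euclidean.1 hA) k
  have hp : ∀ j k, ContinuousOn (pderiv3 (fun y => A y j) k) Ω := fun j k =>
    (hAk j).continuousOn_pderiv3 hΩo k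
  have hdu : ∀ v, ContinuousOn (fun x => fderiv ℝ u x v) Ω := fun v =>
    ((hu.mono subset_closure).continuousOn_fderiv_of_isOpen hΩo le_rfl).clm_apply
      continuousOn_const
  have hAc : ∀ k, ContinuousOn (fun y => A y k) Ω := fun k =>
    (hAk k).continuousOn.mono subset_closure
  have huc : ContinuousOn u Ω := hu.continuousOn.mono subset_closure
  unfold freeEnergyDensity3
  simp only [norm_curl3_sq]
  refine ContinuousOn.add (ContinuousOn.add ?_ ?_) ?_
  · refine continuousOn_finsetSum _ fun k _ => ((hdu _).sub ?_).norm.pow 2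
    exact (continuousOn_const.mul (Complex.continuous_ofReal.comp_continuousOn (hAc k))).mul huc
  · exact continuousOn_const.mul ((continuousOn_const.sub (huc.norm.pow 2)).pow 2)
  · exact ((((hp _ _).sub (hp _ _)).norm.pow 2).add (((hp _ _).sub (hp _ _)).norm.pow 2)).add
      (((hp _ _).sub (hp _ _)).norm.pow 2)

theorem exists_bound_freeEnergyDensity3 (hΩo : IsOpen Ω) (hΩb : Bornology.IsBounded Ω) (ε : ℝ)
    (hu : ContDiffOn ℝ 1 u (closure Ω)) (hA : ContDiffOn ℝ 1 A (closure Ω)) :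
    ∃ C : ℝ, ∀ x ∈ Ω, freeEnergyDensity3 ε u A x ≤ C := by
  have hAk : ∀ k, ContDiffOn ℝ 1 (fun y => A y k) (closure Ω) := fun k =>
    (contDiffOn_euclidean.1 hA) k
  have hp := fun j k => (hAk j).exists_bound_pderiv3 hΩo hΩb k
  choose P hP using hp
  obtain ⟨U, hU⟩ := hΩb.isCompact_closure.exists_bound_of_continuousOn hu.continuousOn
  have ha := fun k => hΩb.isCompact_closure.exists_bound_of_continuousOn (hAk k).continuousOn
  choose a ha using ha
  obtain ⟨D, hD⟩ := hu.exists_bound_fderiv_of_closure hΩo hΩb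
  refine ⟨(∑ k : Fin 3, (D + a k * U) ^ 2) + (1 / (2 * ε ^ 2)) * (1 + U ^ 2) ^ 2 +
    ((P 2 1 + P 1 2) ^ 2 + (P 0 2 + P 2 0) ^ 2 + (P 1 0 + P 0 1) ^ 2), fun x hx => ?_⟩
  have hxc := subset_closure hx
  have hUx := hU x hxc
  unfold freeEnergyDensity3
  rw [norm_curl3_sq]
  have hsub : ∀ i j k l, ‖pderiv3 (fun y => A y i) j x - pderiv3 (fun y => A y k) l x‖ ≤
      P i j + P k l := fun i j k l =>
    (norm_sub_le _ _).trans (add_le_add (hP i j x hx) (hP k l x hx))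
  have hgrad : ∀ k : Fin 3, ‖fderiv ℝ u x (EuclideanSpace.single k 1)
      - Complex.I * (A x k : ℂ) * u x‖ ≤ D + a k * U := by
    intro k
    refine (norm_sub_le _ _).trans (add_le_add ?_ ?_)
    · have := (fderiv ℝ u x).le_opNorm (EuclideanSpace.single k 1)
      simp only [PiLp.norm_single, norm_one, mul_one] at this
      exact this.trans (hD x hx)
    · rw [norm_mul, norm_mul, Complex.norm_I, one_mul, Complex.norm_real]
      exact mul_le_mul (ha k x hxc) hUx (norm_nonneg _) ((norm_nonneg _).trans (ha k x hxc))
  have hpot : (1 - ‖u x‖ ^ 2) ^ 2 ≤ (1 + U ^ 2) ^ 2 := by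
    have h1 : ‖u x‖ ^ 2 ≤ U ^ 2 := pow_le_pow_left₀ (norm_nonneg _) hUx 2
    exact sq_le_sq' (by nlinarith [sq_nonneg ‖u x‖]) (by nlinarith [sq_nonneg ‖u x‖])
  gcongr
  · exact hgrad _
  · exact hsub _ _ _ _
  · exact hsub _ _ _ _
  · exact hsub _ _ _ _

theorem integrableOn_freeEnergyDensity3 (hΩo : IsOpen Ω) (hΩb : Bornology.IsBounded Ω) (ε : ℝ)
    (hu : ContDiffOn ℝ 1 u (closure Ω)) (hA : ContDiffOn ℝ 1 A (closure Ω)) :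
    IntegrableOn (freeEnergyDensity3 ε u A) Ω := by
  obtain ⟨C, hC⟩ := exists_bound_freeEnergyDensity3 hΩo hΩb ε hu hA
  refine IntegrableOn.of_bound hΩb.measure_lt_top
    ((continuousOn_freeEnergyDensity3 hΩo ε hu hA).aestronglyMeasurable hΩo.measurableSet) C ?_
  filter_upwards [ae_restrict_mem hΩo.measurableSet] with x hx
  rw [Real.norm_of_nonneg (freeEnergyDensity3_nonneg ε u A x)]
  exact hC x hx

theorem eventually_abs_norm_sub_norm_le_sqrt_mul (hu : ∀ x ∈ Ω, DifferentiableAt ℝ u x)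
    {x : EuclideanSpace ℝ (Fin 3)} (hx : x ∈ Ω) {κ : ℝ} (hκ : 0 < κ) :
    ∀ᶠ y in 𝓝 x, |‖u y‖ - ‖u x‖| ≤
      (√(∑ k : Fin 3, ‖fderiv ℝ u x (EuclideanSpace.single k 1)
        - Complex.I * (A x k : ℂ) * u x‖ ^ 2) + κ) * ‖y - x‖ := by
  refine eventually_abs_norm_sub_norm_le (hu x hx) (innerSL ℝ (A x)) (fun v => ?_) hκ
  have h := norm_le_sqrt_sum_mul_norm (L := fderiv ℝ u x -
    (Complex.ofRealCLM.comp (innerSL ℝ (A x))).smulRight (Complex.I * u x)) v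
  simp only [sub_apply, ContinuousLinearMap.smulRight_apply,
    ContinuousLinearMap.comp_apply, Complex.ofRealCLM_apply, innerSL_apply_apply, smul_eq_mul,
    EuclideanSpace.inner_single_right, conj_trivial, one_mul] at h
  have hcomm : ∀ c : ℂ, Complex.I * c * u x = c * (Complex.I * u x) := fun c => by ring
  simpa only [hcomm, innerSL_apply_apply] using h

end

/-- The mass that the weight `(1 - t²) / ε` on `(0, 1)` gives to a short interval. -/
theorem withDensity_closedBall_le {ε : ℝ} (hε : 0 < ε) {ρ R κ : ℝ} (hρ : 0 ≤ ρ)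
    (hR : 0 ≤ R) (hRκ : R * (2 + 2 * ρ) ≤ κ * ε) (hρ1 : ρ < 1) :
    ((volume.restrict (Ioo (0 : ℝ) 1)).withDensity fun t => ENNReal.ofReal ((1 - t ^ 2) / ε))
      (closedBall ρ R) ≤ ENNReal.ofReal (((1 - ρ ^ 2) / ε + κ) * (2 * R)) := by
  rw [withDensity_apply _ measurableSet_closedBall, Measure.restrict_restrict
    measurableSet_closedBall]
  have hκ : 0 ≤ κ := nonneg_of_mul_nonneg_left (le_trans (by positivity) hRκ) hε
  have hg : 0 ≤ (1 - ρ ^ 2) / ε := div_nonneg (by nlinarith) hε.le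
  calc ∫⁻ t in closedBall ρ R ∩ Ioo 0 1, ENNReal.ofReal ((1 - t ^ 2) / ε)
      ≤ ∫⁻ t in closedBall ρ R ∩ Ioo 0 1, ENNReal.ofReal ((1 - ρ ^ 2) / ε + κ) := by
        refine setLIntegral_mono' (measurableSet_closedBall.inter measurableSet_Ioo)
          fun t ht => ENNReal.ofReal_le_ofReal ?_
        have h1 : |t - ρ| ≤ R := by simpa [Real.dist_eq] using ht.1
        have h2 := abs_le.1 h1
        have ht0 := ht.2.1
        have ht1 := ht.2.2
        rw [div_add' _ _ _ hε.ne']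
        gcongr
        nlinarith
    _ ≤ ∫⁻ t in closedBall ρ R, ENNReal.ofReal ((1 - ρ ^ 2) / ε + κ) :=
        lintegral_mono_set inter_subset_left
    _ = ENNReal.ofReal (((1 - ρ ^ 2) / ε + κ) * (2 * R)) := by
        rw [setLIntegral_const, Real.volume_closedBall, ← ENNReal.ofReal_mul (by positivity)]

/-- Coarea-type lower bound:
`4 F_ε(u,A) ≥ ∫_0^1 ((1 − t²)/ε) ℋ²({x ∈ Ω : |u(x)| = t}) dt`. -/
theorem stmt19 (Ω : Set (EuclideanSpace ℝ (Fin 3)))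
    (hΩo : IsOpen Ω) (hΩb : Bornology.IsBounded Ω)
    (ε : ℝ) (hε : 0 < ε)
    (u : EuclideanSpace ℝ (Fin 3) → ℂ)
    (A : EuclideanSpace ℝ (Fin 3) → EuclideanSpace ℝ (Fin 3))
    (hu : ContDiffOn ℝ 1 u (closure Ω)) (hA : ContDiffOn ℝ 1 A (closure Ω)) :
    ∫⁻ t in Set.Ioo (0 : ℝ) 1,
        ENNReal.ofReal ((1 - t ^ 2) / ε) * μH[2] {x ∈ Ω | ‖u x‖ = t} ≤
      ENNReal.ofReal (4 * freeEnergy3 ε u A Ω) := by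
  set q := freeEnergyDensity3 ε u A with hq
  have hqi : IntegrableOn q Ω := integrableOn_freeEnergyDensity3 hΩo hΩb ε hu hA
  have hqc : ContinuousOn q Ω := continuousOn_freeEnergyDensity3 hΩo ε hu hA
  have hq0 : ∀ x, 0 ≤ q x := freeEnergyDensity3_nonneg ε u A
  have hF : 4 * freeEnergy3 ε u A Ω = 2 * ∫ x in Ω, q x := by
    simp only [freeEnergy3, hq, freeEnergyDensity3]
    ring
  have hΩfin : volume Ω ≠ ∞ := hΩb.measure_lt_top.ne
  have hud : ∀ x ∈ Ω, DifferentiableAt ℝ u x := fun x hx =>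
    ((hu.mono subset_closure).differentiableOn one_ne_zero).differentiableAt (hΩo.mem_nhds hx)
  let s : Set (EuclideanSpace ℝ (Fin 3)) := {x ∈ Ω | ‖u x‖ < 1}
  let ν : Measure ℝ :=
    (volume.restrict (Ioo (0 : ℝ) 1)).withDensity fun t => ENNReal.ofReal ((1 - t ^ 2) / ε)
  have hν : ∫⁻ t in Set.Ioo (0 : ℝ) 1,
        ENNReal.ofReal ((1 - t ^ 2) / ε) * μH[2] {x ∈ Ω | ‖u x‖ = t} ≤
      ∫⁻ t, μH[2] {x ∈ s | ‖u x‖ = t} ∂ν := by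
    rw [lintegral_withDensity_eq_lintegral_mul_non_measurable _ (by fun_prop)
      (Eventually.of_forall fun _ => ENNReal.ofReal_lt_top)]
    refine setLIntegral_mono' measurableSet_Ioo fun t ht => ?_
    refine mul_le_mul_right (measure_mono ?_) _
    rintro x ⟨hx, rfl⟩
    exact ⟨⟨hx, ht.2⟩, rfl⟩
  have hη : ∀ η : ℝ, 0 < η → ∫⁻ t, μH[2] {x ∈ s | ‖u x‖ = t} ∂ν ≤
      ENNReal.ofReal (4 * freeEnergy3 ε u A Ω + η * volume.real Ω) := by
    intro η hη
    have hint : IntegrableOn (fun x => 2 * q x + η) Ω :=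
      (hqi.const_mul 2).add (integrableOn_const hΩfin)
    let μ : Measure (EuclideanSpace ℝ (Fin 3)) :=
      (volume.restrict Ω).withDensity fun x => ENNReal.ofReal (2 * q x + η)
    have : IsFiniteMeasure μ := isFiniteMeasure_withDensity_ofReal hint.2
    have hμs : μ s ≤ ENNReal.ofReal (4 * freeEnergy3 ε u A Ω + η * volume.real Ω) := by
      refine (measure_mono (subset_univ s)).trans (le_of_eq ?_)
      rw [withDensity_apply _ MeasurableSet.univ, Measure.restrict_univ,
        ← ofReal_integral_eq_lintegral_ofReal hint
          (Eventually.of_forall fun x => by have := hq0 x; positivity),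
        integral_add (hqi.const_mul 2) (integrableOn_const hΩfin), integral_const_mul, hF]
      simp [mul_comm]
    refine le_trans ?_ hμs
    let D : EuclideanSpace ℝ (Fin 3) → ℝ := fun x =>
      √(∑ k : Fin 3, ‖fderiv ℝ u x (EuclideanSpace.single k 1)
        - Complex.I * (A x k : ℂ) * u x‖ ^ 2)
    have hD0 : ∀ x, 0 ≤ D x := fun x => Real.sqrt_nonneg _
    have hκ : ∀ x, ∃ κ : ℝ, 0 < κ ∧
        8 * (D x + κ) * ((1 - ‖u x‖ ^ 2) / ε + κ) ≤ 8 * D x * ((1 - ‖u x‖ ^ 2) / ε) + 2 * η := by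
      intro x
      have hc : Continuous fun κ : ℝ => 8 * (D x + κ) * ((1 - ‖u x‖ ^ 2) / ε + κ) := by fun_prop
      have hlt : 8 * (D x + 0) * ((1 - ‖u x‖ ^ 2) / ε + 0) <
          8 * D x * ((1 - ‖u x‖ ^ 2) / ε) + 2 * η := by
        rw [add_zero, add_zero]
        linarith
      have h := (hc.tendsto 0).eventually (gt_mem_nhds hlt)
      obtain ⟨κ, h1, h2⟩ :=
        ((h.filter_mono nhdsWithin_le_nhds).and (self_mem_nhdsWithin (s := Ioi (0 : ℝ)))).exists
      exact ⟨κ, h2, h1.le⟩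
    choose κ hκ0 hκ using hκ
    refine lintegral_hausdorffMeasure_fiber_le two_pos s (fun x => ‖u x‖) μ ν
      (fun x => D x + κ x) fun x hx => ?_
    have hball : ∀ᶠ y in 𝓝 x, y ∈ Ω ∧ q x - η / 4 < q y ∧
        |‖u y‖ - ‖u x‖| ≤ (D x + κ x) * ‖y - x‖ :=
      (hΩo.eventually_mem hx.1).and (((hqc.continuousAt (hΩo.mem_nhds hx.1)).eventually
        (lt_mem_nhds (by linarith))).and (eventually_abs_norm_sub_norm_le_sqrt_mul hud hx.1 (hκ0 x)))
    obtain ⟨δ, hδ, hball⟩ := Metric.eventually_nhds_iff.1 hball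
    have hsmall : ∀ᶠ r in 𝓝[>] (0 : ℝ), (D x + κ x) * r * (2 + 2 * ‖u x‖) < κ x * ε := by
      have hc : Continuous fun r : ℝ => (D x + κ x) * r * (2 + 2 * ‖u x‖) := by fun_prop
      exact ((hc.tendsto 0).eventually
        (gt_mem_nhds (by simpa using mul_pos (hκ0 x) hε))).filter_mono nhdsWithin_le_nhds
    filter_upwards [hsmall, Ioo_mem_nhdsGT hδ] with r hr hr'
    have hr0 := hr'.1
    have hR : 0 ≤ D x + κ x := add_nonneg (hD0 x) (hκ0 x).le
    have hmem : ∀ y ∈ closedBall x r, dist y x < δ := fun y hy =>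
      (mem_closedBall.1 hy).trans_lt hr'.2
    refine ⟨fun y hy => ((hball (hmem y hy)).2.2).trans ?_, ?_⟩
    · rw [← dist_eq_norm]
      exact mul_le_mul_of_nonneg_left (mem_closedBall.1 hy) hR
    have hg : 0 ≤ (1 - ‖u x‖ ^ 2) / ε :=
      div_nonneg (by nlinarith [hx.2, norm_nonneg (u x)]) hε.le
    have hqx : D x ^ 2 + ((1 - ‖u x‖ ^ 2) / ε) ^ 2 / 2 ≤ q x := by
      have h1 : D x ^ 2 = _ := Real.sq_sqrt (Finset.sum_nonneg fun _ _ => sq_nonneg _)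
      have h2 : ((1 - ‖u x‖ ^ 2) / ε) ^ 2 / 2 = (1 / (2 * ε ^ 2)) * (1 - ‖u x‖ ^ 2) ^ 2 := by
        field_simp
      rw [h1, h2, hq, freeEnergyDensity3]
      exact le_add_of_nonneg_right (sq_nonneg _)
    have hμ : ENNReal.ofReal ((2 * q x + η / 2) * (r ^ 3 * (Real.pi * 4 / 3))) ≤
        μ (closedBall x r) := by
      have hsub : closedBall x r ∩ Ω = closedBall x r :=
        inter_eq_left.2 fun y hy => (hball (hmem y hy)).1
      rw [withDensity_apply _ measurableSet_closedBall,
        Measure.restrict_restrict measurableSet_closedBall, hsub]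
      calc ENNReal.ofReal ((2 * q x + η / 2) * (r ^ 3 * (Real.pi * 4 / 3)))
          = ∫⁻ _ in closedBall x r, ENNReal.ofReal (2 * q x + η / 2) := by
            rw [setLIntegral_const, EuclideanSpace.volume_closedBall_fin_three,
              ENNReal.ofReal_mul (by have := hq0 x; positivity),
              ENNReal.ofReal_mul (by positivity), ENNReal.ofReal_pow hr0.le]
        _ ≤ _ := setLIntegral_mono' measurableSet_closedBall fun y hy =>
            ENNReal.ofReal_le_ofReal (by linarith [(hball (hmem y hy)).2.1])
    refine le_trans ?_ hμ
    refine (mul_le_mul_right (withDensity_closedBall_le hε (norm_nonneg _)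
      (mul_nonneg hR hr0.le) hr.le hx.2) _).trans ?_
    rw [ENNReal.rpow_two, ← ENNReal.ofReal_pow (by positivity),
      ← ENNReal.ofReal_mul (by positivity)]
    refine ENNReal.ofReal_le_ofReal ?_
    set g := (1 - ‖u x‖ ^ 2) / ε
    have hkey : 8 * (D x + κ x) * (g + κ x) ≤ (2 * q x + η / 2) * (Real.pi * 4 / 3) := by
      have h1 : (2 * q x + η / 2) * 4 ≤ (2 * q x + η / 2) * (Real.pi * 4 / 3) :=
        mul_le_mul_of_nonneg_left (by linarith [Real.pi_gt_three]) (by linarith [hq0 x])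
      nlinarith [hκ x, sq_nonneg (D x), sq_nonneg (D x - g)]
    nlinarith [mul_le_mul_of_nonneg_left hkey (pow_pos hr0 3).le]
  refine hν.trans ?_
  have hlim : Tendsto (fun η : ℝ => ENNReal.ofReal (4 * freeEnergy3 ε u A Ω + η * volume.real Ω))
      (𝓝[>] 0) (𝓝 (ENNReal.ofReal (4 * freeEnergy3 ε u A Ω))) := by
    have hc : Continuous fun η : ℝ => 4 * freeEnergy3 ε u A Ω + η * volume.real Ω := by fun_prop
    have h := (hc.tendsto 0).mono_left (nhdsWithin_le_nhds (s := Ioi 0))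
    rw [zero_mul, add_zero] at h
    exact ENNReal.tendsto_ofReal h
  exact ge_of_tendsto hlim (eventually_mem_nhdsWithin.mono hη)
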